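/- Let k be a commutative Artinian ring and A an associative unital k-algebra that is finitely generated as a k-module (an Artin algebra), and let m ≥ 1. A k-derivation D on A is [1,∞]-integrable if and only if it is [m,∞]-integrable. -/

import Mathlib

/-- A `k`-derivation on an associative unital `k`-algebra `A`: a `k`-linear map
satisfying the Leibniz rule. -/
def IsDerivation (k A : Type*) [CommRing k] [Ring A] [Algebra k A]
    (D : A →ₗ[k] A) : Prop :=
  ∀ x y : A, D (x * y) = D x * y + x * D y

/-- `D` is `[m,n)`-integrable: there is a family `α_0 = id, α_1, …, α_{n-1}` of
`k`-linear endomorphisms of `A` with `α_i = 0` for `0 < i < m`, `α_m = D`, and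
satisfying the Hasse–Schmidt convolution identities for all `i < n`. -/
def IsFinIntegrable (k A : Type*) [CommRing k] [Ring A] [Algebra k A]
    (m n : ℕ) (D : A →ₗ[k] A) : Prop :=
  ∃ α : ℕ → (A →ₗ[k] A),
    α 0 = LinearMap.id ∧
    (∀ i, 0 < i → i < m → α i = 0) ∧
    α m = D ∧
    ∀ i, i < n → ∀ x y : A,
      α i (x * y) = ∑ j ∈ Finset.range (i + 1), α j x * α (i - j) y

/-- `D` is `[m,∞]`-integrable: an infinite Hasse–Schmidt family exists
(equivalently, an automorphism of `A⟦t⟧` congruent to `1` mod `t^m` with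
`t^m`-coefficient `D`). -/
def IsInfIntegrable (k A : Type*) [CommRing k] [Ring A] [Algebra k A]
    (m : ℕ) (D : A →ₗ[k] A) : Prop :=
  ∃ α : ℕ → (A →ₗ[k] A),
    α 0 = LinearMap.id ∧
    (∀ i, 0 < i → i < m → α i = 0) ∧
    α m = D ∧
    ∀ i, ∀ x y : A,
      α i (x * y) = ∑ j ∈ Finset.range (i + 1), α j x * α (i - j) y

namespace HasseSchmidt

open PowerSeries Finset

variable {k A : Type*} [CommRing k] [Ring A] [Algebra k A]

/-- The failure of the `n`-th coefficient of `g` to satisfy the convolution identity. -/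
noncomputable def defect (g : (Module.End k A)⟦X⟧) (n : ℕ) (x y : A) : A :=
  coeff n g (x * y) - ∑ p ∈ antidiagonal n, coeff p.1 g x * coeff p.2 g y

theorem sum_antidiagonal_interchange {M : Type*} [AddCommMonoid M] (F : ℕ → ℕ → ℕ → ℕ → M)
    (n : ℕ) :
    ∑ p ∈ antidiagonal n, ∑ q ∈ antidiagonal p.1, ∑ r ∈ antidiagonal p.2,
        F q.1 q.2 r.1 r.2 =
      ∑ p ∈ antidiagonal n, ∑ q ∈ antidiagonal p.1, ∑ r ∈ antidiagonal p.2,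
        F q.1 r.1 q.2 r.2 := by
  simp only [Finset.sum_sigma']
  refine Finset.sum_nbij'
    (fun s => ⟨(s.2.1.1 + s.2.2.1, s.2.1.2 + s.2.2.2), (s.2.1.1, s.2.2.1), (s.2.1.2, s.2.2.2)⟩)
    (fun s => ⟨(s.2.1.1 + s.2.2.1, s.2.1.2 + s.2.2.2), (s.2.1.1, s.2.2.1), (s.2.1.2, s.2.2.2)⟩)
    ?_ ?_ ?_ ?_ ?_
  · rintro ⟨⟨a, b⟩, ⟨c, d⟩, ⟨e, f⟩⟩
    simp; omega
  · rintro ⟨⟨a, b⟩, ⟨c, d⟩, ⟨e, f⟩⟩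
    simp; omega
  · rintro ⟨⟨a, b⟩, ⟨c, d⟩, ⟨e, f⟩⟩
    simp
  · rintro ⟨⟨a, b⟩, ⟨c, d⟩, ⟨e, f⟩⟩
    simp
  · simp

theorem defect_mul (g h : (Module.End k A)⟦X⟧) (n : ℕ) (x y : A) :
    defect (g * h) n x y =
      ∑ p ∈ antidiagonal n, coeff p.1 g (defect h p.2 x y) +
      ∑ p ∈ antidiagonal n, ∑ q ∈ antidiagonal p.2,
        defect g p.1 (coeff q.1 h x) (coeff q.2 h y) := by
  have interchange := sum_antidiagonal_interchange
    (fun a b c d => coeff a g (coeff b h x) * coeff c g (coeff d h y)) n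
  simp only [defect, coeff_mul, LinearMap.sum_apply, Module.End.mul_apply, map_sub, map_sum,
    Finset.sum_sub_distrib, Finset.sum_mul_sum]
  rw [interchange, sub_add_sub_cancel]
  congr 1
  refine Finset.sum_congr rfl fun p _ => ?_
  rw [Finset.sum_comm]

/-- `g = 1 + O(X ^ r)` satisfies the convolution identities in all degrees below `n`. -/
structure IsHSBelow (r n : ℕ) (g : (Module.End k A)⟦X⟧) : Prop where
  coeff_zero : coeff 0 g = 1
  coeff_eq_zero : ∀ i, 0 < i → i < r → coeff i g = 0
  defect_eq_zero : ∀ i < n, defect g i = 0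

theorem coeff_mul_of_low {r N : ℕ} {g h : (Module.End k A)⟦X⟧}
    (hg0 : coeff 0 g = 1) (hg : ∀ i, 0 < i → i < r → coeff i g = 0)
    (hh0 : coeff 0 h = 1) (hh : ∀ i, 0 < i → i < r → coeff i h = 0)
    (hN0 : 0 < N) (hN : N < 2 * r) : coeff N (g * h) = coeff N g + coeff N h := by
  rw [coeff_mul, Finset.sum_eq_add_of_mem (N, 0) (0, N) (by simp) (by simp)
    (by simp; omega)]
  · simp [hg0, hh0]
  · rintro ⟨a, b⟩ hab ⟨h1, h2⟩
    simp only [HasAntidiagonal.mem_antidiagonal, ne_eq, Prod.mk.injEq] at hab h1 h2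
    rcases lt_or_ge a r with h3 | h3
    · simp [hg a (by omega) h3]
    · simp [hh b (by omega) (by omega)]

theorem defect_mul_of_low {r M N : ℕ} {g h : (Module.End k A)⟦X⟧}
    (hg : IsHSBelow r M g) (hh : IsHSBelow r M h) (hN : N < M + r) :
    defect (g * h) N = defect g N + defect h N := by
  ext x y
  rw [defect_mul, Finset.sum_eq_single (0, N), Finset.sum_eq_single (N, 0)]
  · simp [hg.coeff_zero, hh.coeff_zero, add_comm]
  · rintro ⟨a, b⟩ hab hne
    simp only [HasAntidiagonal.mem_antidiagonal, ne_eq, Prod.mk.injEq] at hab hne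
    refine Finset.sum_eq_zero ?_
    rintro ⟨c, d⟩ hcd
    simp only [HasAntidiagonal.mem_antidiagonal] at hcd
    rcases lt_or_ge a M with h1 | h1
    · simp [hg.defect_eq_zero a h1]
    · rcases Nat.eq_zero_or_pos c with h2 | h2
      · have := hh.coeff_eq_zero d (by omega) (by omega)
        simp [this, defect]
      · have := hh.coeff_eq_zero c (by omega) (by omega)
        simp [this, defect]
  · simp
  · rintro ⟨a, b⟩ hab hne
    simp only [HasAntidiagonal.mem_antidiagonal, ne_eq, Prod.mk.injEq] at hab hne
    rcases lt_or_ge b M with h1 | h1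
    · simp [hh.defect_eq_zero b h1]
    · simp [hg.coeff_eq_zero a (by omega) (by omega)]
  · simp

theorem coeff_zero_mul {g h : (Module.End k A)⟦X⟧} (hg : coeff 0 g = 1) (hh : coeff 0 h = 1) :
    coeff 0 (g * h) = 1 := by
  rw [coeff_mul]; simp [hg, hh]

theorem IsHSBelow.mono {r r' n n' : ℕ} {g : (Module.End k A)⟦X⟧} (hg : IsHSBelow r n g)
    (hr : r' ≤ r) (hn : n' ≤ n) : IsHSBelow r' n' g :=
  ⟨hg.coeff_zero, fun i h0 hi => hg.coeff_eq_zero i h0 (hi.trans_le hr),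
    fun i hi => hg.defect_eq_zero i (hi.trans_le hn)⟩

theorem IsHSBelow.mul {r n : ℕ} {g h : (Module.End k A)⟦X⟧} (hg : IsHSBelow r n g)
    (hh : IsHSBelow r n h) : IsHSBelow r n (g * h) where
  coeff_zero := coeff_zero_mul hg.coeff_zero hh.coeff_zero
  coeff_eq_zero i h0 hi := by
    rw [coeff_mul_of_low hg.coeff_zero hg.coeff_eq_zero hh.coeff_zero hh.coeff_eq_zero h0
      (by omega), hg.coeff_eq_zero i h0 hi, hh.coeff_eq_zero i h0 hi, add_zero]
  defect_eq_zero i hi := by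
    rw [defect_mul_of_low hg hh (by omega), hg.defect_eq_zero i hi, hh.defect_eq_zero i hi,
      add_zero]

theorem defect_one (n : ℕ) : defect (1 : (Module.End k A)⟦X⟧) n = 0 := by
  ext x y
  rcases Nat.eq_zero_or_pos n with rfl | hn
  · simp [defect]
  · rw [defect, Finset.sum_eq_zero]
    · simp [coeff_one, hn.ne']
    · rintro ⟨a, b⟩ hab
      simp only [HasAntidiagonal.mem_antidiagonal] at hab
      rcases Nat.eq_zero_or_pos a with h | h
      · simp [coeff_one, show b ≠ 0 by omega]
      · simp [coeff_one, h.ne']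

/-- Substitution of `f` for the variable of `g`. -/
noncomputable def substVar (f : k⟦X⟧) (g : (Module.End k A)⟦X⟧) : (Module.End k A)⟦X⟧ :=
  PowerSeries.mk fun n => ∑ i ∈ range (n + 1), coeff n (f ^ i) • coeff i g

theorem coeff_pow_eq_zero_of_lt {f : k⟦X⟧} (hf : constantCoeff f = 0) {n i : ℕ} (h : n < i) :
    coeff n (f ^ i) = 0 := by
  have : (X : k⟦X⟧) ^ i ∣ f ^ i := pow_dvd_pow_of_dvd (X_dvd_iff.mpr hf) i
  exact X_pow_dvd_iff.mp this n h

theorem coeff_substVar {f : k⟦X⟧} (hf : constantCoeff f = 0) (g : (Module.End k A)⟦X⟧)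
    {n N : ℕ} (h : n ≤ N) :
    coeff n (substVar f g) = ∑ i ∈ range (N + 1), coeff n (f ^ i) • coeff i g := by
  rw [substVar, coeff_mk]
  refine Finset.sum_subset (by simpa using h) fun i _ hi => ?_
  rw [coeff_pow_eq_zero_of_lt hf (by simpa using hi), zero_smul]

theorem defect_substVar {f : k⟦X⟧} (hf : constantCoeff f = 0) (g : (Module.End k A)⟦X⟧) (N : ℕ) :
    defect (substVar f g) N = ∑ i ∈ range (N + 1), coeff N (f ^ i) • defect g i := by
  ext x y
  have key : ∑ p ∈ antidiagonal N, coeff p.1 (substVar f g) x * coeff p.2 (substVar f g) y =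
      ∑ i ∈ range (N + 1), coeff N (f ^ i) •
        ∑ q ∈ antidiagonal i, coeff q.1 g x * coeff q.2 g y := by
    calc _ = ∑ p ∈ antidiagonal N, ∑ i ∈ range (N + 1), ∑ j ∈ range (N + 1),
          (coeff p.1 (f ^ i) * coeff p.2 (f ^ j)) • (coeff i g x * coeff j g y) := by
          refine Finset.sum_congr rfl fun p hp => ?_
          rw [HasAntidiagonal.mem_antidiagonal] at hp
          rw [coeff_substVar hf g (show p.1 ≤ N by omega),
            coeff_substVar hf g (show p.2 ≤ N by omega)]
          simp only [LinearMap.sum_apply, LinearMap.smul_apply, Finset.sum_mul_sum,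
            smul_mul_smul_comm]
      _ = ∑ i ∈ range (N + 1), ∑ j ∈ range (N + 1),
          coeff N (f ^ (i + j)) • (coeff i g x * coeff j g y) := by
          rw [Finset.sum_comm]
          refine Finset.sum_congr rfl fun i _ => ?_
          rw [Finset.sum_comm]
          refine Finset.sum_congr rfl fun j _ => ?_
          rw [← Finset.sum_smul, pow_add, coeff_mul]
      _ = _ := by
          simp only [Finset.smul_sum]
          rw [← Finset.sum_product', Finset.sum_sigma']
          symm
          refine Finset.sum_of_injOn (fun s => s.2) ?_ ?_ ?_ ?_
          · rintro ⟨a, b, c⟩ h1 ⟨a', b', c'⟩ h2 h3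
            simp at h1 h2 h3 ⊢
            omega
          · rintro ⟨a, b, c⟩ h1
            simp at h1 ⊢
            omega
          · rintro ⟨b, c⟩ h1 h2
            have : N < b + c := by
              by_contra h3
              exact h2 ⟨⟨b + c, b, c⟩, by simp; omega, rfl⟩
            simp [coeff_pow_eq_zero_of_lt hf this]
          · rintro ⟨a, b, c⟩ h1
            simp at h1 ⊢
            rw [h1.2]
  rw [defect, key, coeff_substVar hf g le_rfl]
  simp [defect, smul_sub, Finset.sum_sub_distrib]

theorem IsHSBelow.one (r n : ℕ) : IsHSBelow r n (1 : (Module.End k A)⟦X⟧) :=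
  ⟨by simp, fun i h0 _ => by simp [coeff_one, h0.ne'], fun i _ => defect_one i⟩

theorem IsHSBelow.exists_inverse {r n : ℕ} (hr : 0 < r) {g : (Module.End k A)⟦X⟧}
    (hg : IsHSBelow r n g) : ∃ h, IsHSBelow r n h ∧ g * h = 1 := by
  obtain ⟨h, h0, hgh⟩ : ∃ h : (Module.End k A)⟦X⟧, coeff 0 h = 1 ∧ g * h = 1 :=
    ⟨invOfUnit g 1, by simp, mul_invOfUnit g 1 (by simpa using hg.coeff_zero)⟩
  refine ⟨h, ⟨h0, fun i hi0 hir => ?_, fun i => ?_⟩, hgh⟩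
  · have e : coeff i (g * h) = coeff i h := by
      rw [coeff_mul, Finset.sum_eq_single (0, i)]
      · simp [hg.coeff_zero]
      · rintro ⟨a, b⟩ hab hne
        simp only [HasAntidiagonal.mem_antidiagonal, ne_eq, Prod.mk.injEq] at hab hne
        simp [hg.coeff_eq_zero a (by omega) (by omega)]
      · simp
    rw [← e, hgh, coeff_one, if_neg hi0.ne']
  · induction i using Nat.strong_induction_on with
    | _ i ih =>
      intro hi
      have hh : IsHSBelow 1 i h := ⟨h0, fun _ _ _ => by omega, fun j hj => ih j hj (hj.trans hi)⟩
      have e := defect_mul_of_low (hg.mono hr hi.le) hh (N := i) (by omega)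
      rw [hgh, defect_one, hg.defect_eq_zero i hi, zero_add] at e
      exact e.symm

variable (k A) in
/-- The defects in degree `n` of the series `1 + O(X ^ (r + 1))` satisfying the convolution
identities below degree `n`. -/
def obstructions (r n : ℕ) : AddSubgroup (A → A → A) where
  carrier := {e | ∃ g : (Module.End k A)⟦X⟧, IsHSBelow (r + 1) n g ∧ defect g n = e}
  zero_mem' := ⟨1, IsHSBelow.one _ _, defect_one n⟩
  add_mem' := by
    rintro _ _ ⟨g, hg, rfl⟩ ⟨h, hh, rfl⟩
    exact ⟨g * h, hg.mul hh, defect_mul_of_low hg hh (by omega)⟩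
  neg_mem' := by
    rintro _ ⟨g, hg, rfl⟩
    obtain ⟨h, hh, hgh⟩ := hg.exists_inverse (by omega)
    refine ⟨h, hh, ?_⟩
    have e := defect_mul_of_low hg hh (N := n) (by omega)
    rw [hgh, defect_one] at e
    exact eq_neg_of_add_eq_zero_right e.symm

theorem IsHSBelow.substVar {L n : ℕ} (hL : 0 < L) {f : k⟦X⟧} (hf : X ^ L ∣ f)
    {g : (Module.End k A)⟦X⟧} (hg : IsHSBelow 1 n g) : IsHSBelow L (L * n) (substVar f g) := by
  have hf0 : constantCoeff f = 0 := X_dvd_iff.mp ((dvd_pow_self X hL.ne').trans hf)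
  have hpow (s N : ℕ) (hN : N < L * s) : coeff N (f ^ s) = 0 :=
    X_pow_dvd_iff.mp (by rw [pow_mul]; exact pow_dvd_pow_of_dvd hf s) N hN
  refine ⟨?_, fun i hi0 hi => ?_, fun i hi => ?_⟩
  · simp [coeff_substVar hf0 g le_rfl, hg.coeff_zero]
  · rw [coeff_substVar hf0 g le_rfl]
    refine Finset.sum_eq_zero fun s _ => ?_
    rcases Nat.eq_zero_or_pos s with rfl | hs
    · simp [coeff_one, hi0.ne']
    · rw [hpow s i (by nlinarith), zero_smul]
  · rw [defect_substVar hf0]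
    refine Finset.sum_eq_zero fun s _ => ?_
    rcases lt_or_ge s n with hs | hs
    · rw [hg.defect_eq_zero s hs, smul_zero]
    · rw [hpow s i (hi.trans_le (Nat.mul_le_mul_left L hs)), zero_smul]

theorem coeff_monomial_pow (c : k) (m s N : ℕ) :
    coeff N ((C c * X ^ m : k⟦X⟧) ^ s) = if N = m * s then c ^ s else 0 := by
  rw [mul_pow, ← map_pow, ← pow_mul, coeff_C_mul, coeff_X_pow]
  simp

theorem constantCoeff_monomial (c : k) {m : ℕ} (hm : 0 < m) :
    constantCoeff (C c * X ^ m : k⟦X⟧) = 0 := by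
  simp [hm.ne']

theorem coeff_substVar_monomial (c : k) {m : ℕ} (hm : 0 < m) (g : (Module.End k A)⟦X⟧) (s : ℕ) :
    coeff (m * s) (substVar (C c * X ^ m) g) = c ^ s • coeff s g := by
  rw [coeff_substVar (constantCoeff_monomial c hm) g le_rfl, Finset.sum_eq_single s]
  · simp [coeff_monomial_pow]
  · intro b _ hb
    rw [coeff_monomial_pow, if_neg, zero_smul]
    intro h
    exact hb (Nat.eq_of_mul_eq_mul_left hm h).symm
  · intro h
    exact absurd (Finset.mem_range.mpr (by nlinarith)) h

theorem defect_substVar_monomial (c : k) {m : ℕ} (hm : 0 < m) (g : (Module.End k A)⟦X⟧) (s : ℕ) :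
    defect (substVar (C c * X ^ m) g) (m * s) = c ^ s • defect g s := by
  rw [defect_substVar (constantCoeff_monomial c hm), Finset.sum_eq_single s]
  · simp [coeff_monomial_pow]
  · intro b _ hb
    rw [coeff_monomial_pow, if_neg, zero_smul]
    intro h
    exact hb (Nat.eq_of_mul_eq_mul_left hm h).symm
  · intro h
    exact absurd (Finset.mem_range.mpr (by nlinarith)) h

theorem defect_substVar_monomial_of_not_dvd (c : k) {m N : ℕ} (hm : 0 < m) (hN : ¬ m ∣ N)
    (g : (Module.End k A)⟦X⟧) : defect (substVar (C c * X ^ m) g) N = 0 := by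
  rw [defect_substVar (constantCoeff_monomial c hm)]
  refine Finset.sum_eq_zero fun s _ => ?_
  rw [coeff_monomial_pow, if_neg (fun h => hN ⟨s, h⟩), zero_smul]

theorem obstructions_le_of_dvd {d n : ℕ} (hn : 0 < n) (h : d ∣ n) :
    obstructions k A 0 d ≤ obstructions k A (n / d - 1) n := by
  rintro _ ⟨g, hg, rfl⟩
  obtain ⟨m, rfl⟩ := h
  have hm : 0 < m := Nat.pos_of_mul_pos_left hn
  have hd : 0 < d := Nat.pos_of_mul_pos_right hn
  have := hg.substVar hm (f := C 1 * X ^ m) (Dvd.intro_left _ rfl)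
  refine ⟨substVar (C 1 * X ^ m) g, this.mono ?_ (mul_comm d m).le, ?_⟩
  · rw [Nat.mul_div_cancel_left _ hd]; omega
  · rw [mul_comm d m, defect_substVar_monomial 1 hm, one_pow, one_smul]

theorem obstructions_anti {r r' n : ℕ} (h : r ≤ r') :
    obstructions k A r' n ≤ obstructions k A r n := by
  rintro _ ⟨g, hg, rfl⟩
  exact ⟨g, hg.mono (by omega) le_rfl, rfl⟩

variable (k A) in
/-- Leading coefficients in degree `i` extend to series of order one, up to degree `n`. -/
def LeadingCoeffsLift (n : ℕ) : Prop :=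
  ∀ i > 0, ∀ g : (Module.End k A)⟦X⟧, IsHSBelow i (i * n + 1) g →
    ∃ h : (Module.End k A)⟦X⟧, IsHSBelow 1 (n + 1) h ∧ coeff 1 h = coeff i g

theorem defect_congr {g h : (Module.End k A)⟦X⟧} {n : ℕ}
    (e : ∀ i ≤ n, coeff i g = coeff i h) : defect g n = defect h n := by
  ext x y
  simp only [defect, e n le_rfl]
  congr 1
  refine Finset.sum_congr rfl fun p hp => ?_
  rw [HasAntidiagonal.mem_antidiagonal] at hp
  rw [e p.1 (by omega), e p.2 (by omega)]

theorem defect_eq_zero_of_coeff_eq_zero {g : (Module.End k A)⟦X⟧} {N : ℕ}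
    (h0 : coeff 0 g = 1) (h : ∀ i, 0 < i → i ≤ N → coeff i g = 0) : defect g N = 0 := by
  rw [← defect_one (k := k) (A := A) N]
  refine defect_congr fun i hi => ?_
  rcases Nat.eq_zero_or_pos i with rfl | hi0
  · simp [h0]
  · simp [h i hi0 hi, coeff_one, hi0.ne']

theorem IsHSBelow.mul_substVar_neg {i M n : ℕ} (hi : 0 < i) {g h : (Module.End k A)⟦X⟧}
    (hg : IsHSBelow i M g) (hh : IsHSBelow 1 n h) (hM : M ≤ i * n)
    (e : coeff 1 h = coeff i g) :
    IsHSBelow (i + 1) M (g * HasseSchmidt.substVar (C (-1) * X ^ i) h) := by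
  have hs := (hh.substVar hi (f := C (-1) * X ^ i) (Dvd.intro_left _ rfl)).mono le_rfl hM
  have hm := hg.mul hs
  refine ⟨hm.coeff_zero, fun j h0 hj => ?_, hm.defect_eq_zero⟩
  rcases Nat.lt_succ_iff_lt_or_eq.mp hj with hj | rfl
  · exact hm.coeff_eq_zero j h0 hj
  · have hc := coeff_substVar_monomial (-1) hi h 1
    rw [mul_one, e] at hc
    rw [coeff_mul_of_low hg.coeff_zero hg.coeff_eq_zero hs.coeff_zero hs.coeff_eq_zero h0
      (by omega), hc]
    ext x
    simp

/-- The defects of a series `1 + O(X ^ i)` shortly after the first one come from obstructions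
of series of order one. -/
theorem defect_mem_iSup_obstructions {M N i : ℕ} (hi : 0 < i) (hM : M ≤ N)
    (hM0 : 0 < M) (hN : N < M + i)
    (hlift : ∀ d, d * i < M → LeadingCoeffsLift k A d)
    {g : (Module.End k A)⟦X⟧} (hg : IsHSBelow i M g) :
    defect g N ∈ ⨆ d ∈ {d | d ∣ N ∧ d * i ≤ N}, obstructions k A 0 d := by
  by_cases hiN : N < i
  · rw [defect_eq_zero_of_coeff_eq_zero hg.coeff_zero
      fun j h0 hj => hg.coeff_eq_zero j h0 (by omega)]
    exact zero_mem _
  rw [not_lt] at hiN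
  set d := (M - 1) / i with hd
  have hdM : d * i < M := by
    have := Nat.div_mul_le_self (M - 1) i
    rw [← hd] at this
    omega
  have hMd : M ≤ i * (d + 1) := by
    have := Nat.lt_mul_div_succ (M - 1) hi
    rw [← hd] at this
    omega
  obtain ⟨h, hh, hhg⟩ := hlift d hdM i hi g (hg.mono le_rfl (by rw [mul_comm]; omega))
  have hs := hh.substVar hi (f := C (-1) * X ^ i) (Dvd.intro_left _ rfl)
  have hs' := hs.mono le_rfl hMd
  set u := HasseSchmidt.substVar (C (-1) * X ^ i) h with hu
  have hgu : IsHSBelow (i + 1) M (g * u) := hg.mul_substVar_neg hi hh hMd hhg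
  have ih := defect_mem_iSup_obstructions (i := i + 1) (by omega) hM hM0 (by omega)
    (fun d hd => hlift d (by nlinarith)) hgu
  rw [defect_mul_of_low hg hs' hN] at ih
  have mono : (⨆ d ∈ {d | d ∣ N ∧ d * (i + 1) ≤ N}, obstructions k A 0 d) ≤
      ⨆ d ∈ {d | d ∣ N ∧ d * i ≤ N}, obstructions k A 0 d :=
    biSup_mono fun d hd => ⟨hd.1, by have := hd.2; nlinarith⟩
  refine (add_mem_cancel_right ?_).mp (mono ih)
  by_cases hdvd : i ∣ N
  · obtain ⟨s, rfl⟩ := hdvd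
    rw [hu, defect_substVar_monomial (-1) hi]
    have hsd : s ≤ d + 1 := by
      have : i * s < i * (d + 2) := by nlinarith
      have := Nat.lt_of_mul_lt_mul_left this
      omega
    have hmem : defect h s ∈ obstructions k A 0 s := ⟨h, hh.mono le_rfl hsd, rfl⟩
    have hle : obstructions k A 0 s ≤
        ⨆ d ∈ {d | d ∣ i * s ∧ d * i ≤ i * s}, obstructions k A 0 d :=
      le_biSup (obstructions k A 0) ⟨Dvd.intro_left _ rfl, (mul_comm s i).le⟩
    rcases neg_one_pow_eq_or k s with e | e
    · rw [e, one_smul]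
      exact hle hmem
    · rw [e, neg_one_smul]
      exact neg_mem (hle hmem)
  · rw [hu, defect_substVar_monomial_of_not_dvd _ hi hdvd]
    exact zero_mem _
termination_by N + 1 - i

theorem coeff_substVar_of_lt {L i : ℕ} (hL : 0 < L) {f : k⟦X⟧} (hf : X ^ L ∣ f)
    (g : (Module.End k A)⟦X⟧) (hi0 : 0 < i) (hi : i < 2 * L) :
    coeff i (substVar f g) = coeff i f • coeff 1 g := by
  have hf0 : constantCoeff f = 0 := X_dvd_iff.mp ((dvd_pow_self X hL.ne').trans hf)
  rw [coeff_substVar hf0 g le_rfl, Finset.sum_eq_single 1]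
  · rw [pow_one]
  · intro s _ hs
    rcases Nat.eq_zero_or_pos s with rfl | hs0
    · simp [coeff_one, hi0.ne']
    · have : (X : k⟦X⟧) ^ (L * s) ∣ f ^ s := by rw [pow_mul]; exact pow_dvd_pow_of_dvd hf s
      rw [X_pow_dvd_iff.mp this i (hi.trans_le (by nlinarith [show 2 ≤ s by omega])), zero_smul]
  · intro h
    exact absurd (Finset.mem_range.mpr (by omega)) h

theorem defect_substVar_of_lt {L n N : ℕ} (hL : 0 < L) {f : k⟦X⟧} (hf : X ^ L ∣ f)
    {g : (Module.End k A)⟦X⟧} (hg : IsHSBelow 1 n g) (hN : N < L * (n + 1)) :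
    defect (substVar f g) N = coeff N (f ^ n) • defect g n := by
  have hf0 : constantCoeff f = 0 := X_dvd_iff.mp ((dvd_pow_self X hL.ne').trans hf)
  rw [defect_substVar hf0, Finset.sum_eq_single n]
  · intro s _ hs
    rcases lt_or_ge s n with h | h
    · rw [hg.defect_eq_zero s h, smul_zero]
    · have : (X : k⟦X⟧) ^ (L * s) ∣ f ^ s := by rw [pow_mul]; exact pow_dvd_pow_of_dvd hf s
      have h' : n + 1 ≤ s := by omega
      rw [X_pow_dvd_iff.mp this N (hN.trans_le (Nat.mul_le_mul_left L h')), zero_smul]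
  · intro h
    rw [coeff_pow_eq_zero_of_lt hf0 (by simpa using h), zero_smul]

theorem coeff_one_add_X_pow (n j : ℕ) : coeff j ((1 + X : k⟦X⟧) ^ n) = (n.choose j : k) := by
  have : ((1 + X : k⟦X⟧) ^ n) = (((1 + Polynomial.X) ^ n : Polynomial k) : k⟦X⟧) := by simp
  rw [this, Polynomial.coeff_coe, Polynomial.coeff_one_add_X_pow]

theorem choose_nsmul_mem_obstructions {n j : ℕ} (hj0 : 0 < j) (hjn : j < n)
    (hlift : ∀ d < n, LeadingCoeffsLift k A d) {e : A → A → A}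
    (he : e ∈ obstructions k A 0 n) : n.choose j • e ∈ obstructions k A 0 j := by
  obtain ⟨g, hg, rfl⟩ := he
  rw [zero_add] at hg
  set L := n.factorial with hLdef
  have hnL : n ≤ L := Nat.self_le_factorial n
  have hL : 0 < L := by omega
  set N := L * n + j with hNdef
  have hN : N < L * (n + 1) := by rw [mul_add]; omega
  set f₁ : k⟦X⟧ := X ^ L with hf₁
  set f₂ : k⟦X⟧ := X ^ (L + 1) with hf₂
  set f₃ : k⟦X⟧ := -(X ^ L * (1 + X)) with hf₃
  have d₁ : X ^ L ∣ f₁ := dvd_rfl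
  have d₂ : X ^ L ∣ f₂ := pow_dvd_pow X (Nat.le_succ L)
  have d₃ : X ^ L ∣ f₃ := (dvd_mul_right _ _).neg_right
  have hf : f₁ + f₂ + f₃ = 0 := by rw [hf₁, hf₂, hf₃]; ring
  have h₁ := hg.substVar hL d₁
  have h₂ := hg.substVar hL d₂
  have h₃ := hg.substVar hL d₃
  have h₁₂ := h₁.mul h₂
  have h₁₂₃ := h₁₂.mul h₃
  set u := substVar f₁ g * substVar f₂ g * substVar f₃ g with hu
  have hlow : IsHSBelow (2 * L) (L * n) u := by
    refine ⟨h₁₂₃.coeff_zero, fun i h0 hi => ?_, h₁₂₃.defect_eq_zero⟩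
    rw [hu, coeff_mul_of_low h₁₂.coeff_zero h₁₂.coeff_eq_zero h₃.coeff_zero h₃.coeff_eq_zero h0 hi,
      coeff_mul_of_low h₁.coeff_zero h₁.coeff_eq_zero h₂.coeff_zero h₂.coeff_eq_zero h0 hi,
      coeff_substVar_of_lt hL d₁ g h0 hi, coeff_substVar_of_lt hL d₂ g h0 hi,
      coeff_substVar_of_lt hL d₃ g h0 hi, ← add_smul, ← add_smul, ← map_add, ← map_add, hf,
      map_zero, zero_smul]
  have hNM : N < L * n + L := by omega
  have hdef : defect u N = ((-1) ^ n * (n.choose j : k)) • defect g n := by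
    rw [hu, defect_mul_of_low h₁₂ h₃ hNM, defect_mul_of_low h₁ h₂ hNM,
      defect_substVar_of_lt hL d₁ hg hN, defect_substVar_of_lt hL d₂ hg hN,
      defect_substVar_of_lt hL d₃ hg hN, ← add_smul, ← add_smul]
    congr 1
    rw [hf₁, hf₂, hf₃, ← pow_mul, ← pow_mul, coeff_X_pow, coeff_X_pow, neg_pow, mul_pow, ← pow_mul,
      if_neg (by omega), if_neg (by rw [add_mul]; omega), zero_add, zero_add]
    have : ((-1 : k⟦X⟧)) ^ n = C ((-1) ^ n) := by simp
    rw [this, coeff_C_mul, hNdef, add_comm (L * n) j, coeff_X_pow_mul, coeff_one_add_X_pow]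
  have hmem := defect_mem_iSup_obstructions (M := L * n) (N := N) (by omega) (by omega)
    (Nat.mul_pos hL (by omega)) (by omega) (fun d hd => hlift d (by nlinarith)) hlow
  have hle : (⨆ d ∈ {d | d ∣ N ∧ d * (2 * L) ≤ N}, obstructions k A 0 d) ≤
      obstructions k A 0 j := by
    refine iSup₂_le fun d hd => ?_
    obtain ⟨hdN, hdle⟩ := hd
    have hd0 : 0 < d := Nat.pos_of_dvd_of_pos hdN (by omega)
    have hdn : d ≤ n := by
      by_contra h
      have : (n + 1) * L ≤ d * L := Nat.mul_le_mul_right L (by omega)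
      nlinarith
    have hdL : d ∣ L * n := (Nat.dvd_factorial hd0 hdn).mul_right n
    exact (obstructions_le_of_dvd hj0 ((Nat.dvd_add_right hdL).mp hdN)).trans
      (obstructions_anti (Nat.zero_le _))
  have hres := hle hmem
  rw [hdef, mul_smul, Nat.cast_smul_eq_nsmul] at hres
  rcases neg_one_pow_eq_or k n with h | h
  · rwa [h, one_smul] at hres
  · rw [h, neg_smul, one_smul] at hres
    exact (neg_mem_iff).mp hres

theorem not_dvd_choose_prime_pow_mul {p : ℕ} (hp : p.Prime) {r : ℕ} (hr : ¬ p ∣ r) (a : ℕ) :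
    ¬ p ∣ (p ^ a * r).choose (p ^ a) := by
  have : Fact p.Prime := ⟨hp⟩
  induction a with
  | zero => simpa using hr
  | succ a ih =>
    have h := Choose.choose_modEq_choose_mod_mul_choose_div_nat (p := p)
      (n := p ^ (a + 1) * r) (k := p ^ (a + 1))
    rw [pow_succ', mul_assoc, Nat.mul_mod_right, Nat.mul_mod_right,
      Nat.mul_div_cancel_left _ hp.pos, Nat.mul_div_cancel_left _ hp.pos, Nat.choose_self,
      one_mul] at h
    rw [pow_succ', mul_assoc]
    rwa [h.dvd_iff dvd_rfl]

theorem exists_nsmul_mem_obstructions_ordProj {n p : ℕ} (hn : 0 < n) (hp : p.Prime)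
    (hlift : ∀ d < n, LeadingCoeffsLift k A d) :
    ∃ c : ℕ, ¬ p ∣ c ∧ ∀ e ∈ obstructions k A 0 n,
      c • e ∈ obstructions k A 0 (p ^ n.factorization p) := by
  rcases (Nat.ordProj_le p hn.ne').eq_or_lt with h | h
  · exact ⟨1, hp.one_lt.ne' ∘ Nat.dvd_one.mp, fun e he => by rwa [h, one_smul]⟩
  · refine ⟨n.choose (p ^ n.factorization p), ?_,
      fun e he => choose_nsmul_mem_obstructions (Nat.ordProj_pos n p) h hlift he⟩
    have := not_dvd_choose_prime_pow_mul hp (Nat.not_dvd_ordCompl hp hn.ne') (n.factorization p)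
    rwa [Nat.ordProj_mul_ordCompl_eq_self] at this

theorem mem_of_nsmul_mem {G : Type*} [AddCommGroup G] {S : AddSubgroup G} {e : G} {n : ℕ}
    (hn : n • e ∈ S) (h : ∀ p, p.Prime → p ∣ n → ∃ c : ℕ, ¬ p ∣ c ∧ c • e ∈ S) : e ∈ S := by
  let I : AddSubgroup ℤ := S.comap (zmultiplesHom G e)
  have hI (c : ℕ) : (c : ℤ) ∈ I ↔ c • e ∈ S := by simp [I]
  obtain ⟨a, ha⟩ := Int.subgroup_cyclic I
  have hdvd (c : ℕ) : c • e ∈ S ↔ a ∣ (c : ℤ) := by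
    rw [← hI, ha, ← AddSubgroup.zmultiples_eq_closure, Int.mem_zmultiples_iff]
  by_cases hu : a.natAbs = 1
  · rw [← one_smul ℕ e, hdvd, ← Int.natAbs_dvd, hu]
  · obtain ⟨p, hp, hpa⟩ := Nat.exists_prime_and_dvd hu
    have hpa' : (p : ℤ) ∣ a := Int.natCast_dvd.mpr hpa
    obtain ⟨c, hc, hcS⟩ := h p hp (Int.natCast_dvd_natCast.mp (hpa'.trans ((hdvd n).mp hn)))
    exact absurd (Int.natCast_dvd_natCast.mp (hpa'.trans ((hdvd c).mp hcS))) hc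

theorem obstructions_le_one_of_dvd {d n : ℕ} (h : d ∣ n) (hd : d < n) :
    obstructions k A 0 d ≤ obstructions k A 1 n := by
  refine (obstructions_le_of_dvd (by omega) h).trans (obstructions_anti ?_)
  obtain ⟨m, rfl⟩ := h
  have hd0 : 0 < d := Nat.pos_of_ne_zero (by rintro rfl; simp at hd)
  rw [Nat.mul_div_cancel_left _ hd0]
  by_contra hm
  have : m ≤ 1 := by omega
  nlinarith

theorem leadingCoeffsLift (n : ℕ) : LeadingCoeffsLift k A n := by
  induction n using Nat.strong_induction_on with
  | _ n ih =>
  intro i hi g hg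
  rcases Nat.eq_zero_or_pos n with rfl | hn
  · refine ⟨PowerSeries.mk fun j => if j = 0 then 1 else coeff i g,
      ⟨by simp, fun _ _ _ => by omega, fun j hj => ?_⟩, by simp⟩
    obtain rfl : j = 0 := by omega
    ext x y
    simp [defect]
  obtain ⟨b, hb, hbg⟩ := ih (n - 1) (by omega) i hi g
    (hg.mono le_rfl (by have := Nat.mul_le_mul_left i (Nat.sub_le n 1); omega))
  rw [Nat.sub_add_cancel hn] at hb
  have hbmem : defect b n ∈ obstructions k A 0 n := ⟨b, hb, rfl⟩
  have hs := hb.substVar hi (f := C (-1) * X ^ i) (Dvd.intro_left _ rfl)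
  have hg' := hg.mono le_rfl (Nat.le_succ (i * n))
  set u := substVar (C (-1) * X ^ i) b with hu
  have hgu : IsHSBelow (i + 1) (i * n) (g * u) := hg'.mul_substVar_neg hi hb le_rfl hbg
  have hmem := defect_mem_iSup_obstructions (by omega) le_rfl (Nat.mul_pos hi hn) (by omega)
    (fun d hd => ih d (by by_contra h; nlinarith [Nat.mul_le_mul_right i (not_lt.mp h)])) hgu
  have hle : (⨆ d ∈ {d | d ∣ i * n ∧ d * (i + 1) ≤ i * n}, obstructions k A 0 d) ≤
      ⨆ d ∈ Set.Ioo 0 n, obstructions k A 0 d := by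
    refine biSup_mono fun d hd => ⟨Nat.pos_of_dvd_of_pos hd.1 (Nat.mul_pos hi hn), ?_⟩
    have := hd.2
    by_contra h
    nlinarith [Nat.mul_le_mul_right i (not_lt.mp h)]
  replace hmem := hle hmem
  rw [defect_mul_of_low hg' hs (by omega), hg.defect_eq_zero _ (by omega), zero_add, hu,
    defect_substVar_monomial _ hi] at hmem
  replace hmem : defect b n ∈ ⨆ d ∈ Set.Ioo 0 n, obstructions k A 0 d := by
    rcases neg_one_pow_eq_or k n with h | h
    · rwa [h, one_smul] at hmem
    · rw [h, neg_smul, one_smul] at hmem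
      exact neg_mem_iff.mp hmem
  have hprime (p : ℕ) (hp : p.Prime) (hpn : p ∣ n) :
      ∃ c : ℕ, ¬ p ∣ c ∧ c • defect b n ∈ obstructions k A 1 n := by
    rcases (Nat.ordProj_le p hn.ne').eq_or_lt with h | h
    · have hc (d : ℕ) : ∃ c : ℕ, ¬ p ∣ c ∧ (d ∈ Set.Ioo 0 n → ∀ e ∈ obstructions k A 0 d,
          c • e ∈ obstructions k A 1 n) := by
        by_cases hd : d ∈ Set.Ioo 0 n
        · obtain ⟨c, hpc, hc⟩ := exists_nsmul_mem_obstructions_ordProj (k := k) (A := A) hd.1 hp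
            fun d' hd' => ih d' (hd'.trans hd.2)
          have hlt : p ^ d.factorization p < n := (Nat.ordProj_le p hd.1.ne').trans_lt hd.2
          refine ⟨c, hpc, fun _ e he => obstructions_le_one_of_dvd ?_ hlt (hc e he)⟩
          rw [← h] at hlt ⊢
          exact pow_dvd_pow p ((Nat.pow_lt_pow_iff_right hp.one_lt).mp hlt).le
        · exact ⟨1, hp.one_lt.ne' ∘ Nat.dvd_one.mp, fun h => absurd h hd⟩
      choose c hpc hc using hc
      refine ⟨∏ d ∈ range n, c d, ?_, ?_⟩
      · rw [hp.prime.dvd_finsetProd_iff]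
        rintro ⟨d, _, hd⟩
        exact hpc d hd
      · let S : AddSubgroup (A → A → A) :=
          (obstructions k A 1 n).comap (nsmulAddMonoidHom (∏ d ∈ range n, c d))
        have hS : (⨆ d ∈ Set.Ioo 0 n, obstructions k A 0 d) ≤ S := by
          refine iSup₂_le fun d hd e he => ?_
          obtain ⟨q, hq⟩ := Finset.dvd_prod_of_mem c (Finset.mem_range.mpr hd.2)
          simp only [S, AddSubgroup.mem_comap, nsmulAddMonoidHom_apply, hq]
          rw [mul_comm, mul_smul]
          exact nsmul_mem (hc d hd e he) q
        exact hS hmem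
    · obtain ⟨c, hpc, hc⟩ := exists_nsmul_mem_obstructions_ordProj (k := k) (A := A) hn hp ih
      exact ⟨c, hpc, obstructions_le_one_of_dvd (Nat.ordProj_dvd n p) h (hc _ hbmem)⟩
  have hfin : defect b n ∈ obstructions k A 1 n := by
    rcases (Nat.succ_le_of_lt hn).eq_or_lt with h | h
    · have h1 : n = 1 := h.symm
      subst h1
      have : Set.Ioo 0 1 = (∅ : Set ℕ) := by ext; simp; omega
      simp only [this, Set.mem_empty_iff_false, iSup_false, iSup_bot, AddSubgroup.mem_bot] at hmem
      rw [hmem]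
      exact zero_mem _
    · refine mem_of_nsmul_mem (obstructions_le_one_of_dvd (one_dvd n) h ?_) hprime
      simpa using choose_nsmul_mem_obstructions one_pos h ih hbmem
  obtain ⟨v, hv, hvd⟩ := neg_mem hfin
  have hv1 := hv.mono (show 1 ≤ 1 + 1 by omega) le_rfl
  have hbv := hb.mul hv1
  refine ⟨b * v, ⟨hbv.coeff_zero, hbv.coeff_eq_zero, fun j hj => ?_⟩, ?_⟩
  · rcases Nat.lt_succ_iff_lt_or_eq.mp hj with hj | rfl
    · exact hbv.defect_eq_zero j hj
    · rw [defect_mul_of_low hb hv1 (by omega), hvd, add_neg_cancel]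
  · rw [coeff_mul_of_low hb.coeff_zero hb.coeff_eq_zero hv1.coeff_zero hv1.coeff_eq_zero
      one_pos (by omega), hv.coeff_eq_zero 1 one_pos (by omega), add_zero, hbg]

variable (k A) in
/-- The linear terms of series satisfying the convolution identities up to degree `n`. -/
noncomputable def linearTerms (n : ℕ) : Submodule k (Module.End k A) where
  carrier := {D | ∃ g : (Module.End k A)⟦X⟧, IsHSBelow 1 (n + 1) g ∧ coeff 1 g = D}
  zero_mem' := ⟨1, IsHSBelow.one _ _, by simp [coeff_one]⟩
  add_mem' := by
    rintro _ _ ⟨g, hg, rfl⟩ ⟨h, hh, rfl⟩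
    exact ⟨g * h, hg.mul hh, coeff_mul_of_low hg.coeff_zero hg.coeff_eq_zero hh.coeff_zero
      hh.coeff_eq_zero one_pos (by omega)⟩
  smul_mem' := by
    rintro c _ ⟨g, hg, rfl⟩
    refine ⟨substVar (C c * X ^ 1) g, ?_, ?_⟩
    · simpa using hg.substVar one_pos (f := C c * X ^ 1) (Dvd.intro_left _ rfl)
    · simpa using coeff_substVar_monomial c one_pos g 1

theorem linearTerms_antitone : Antitone (linearTerms k A) := by
  rintro m n hmn _ ⟨g, hg, rfl⟩
  exact ⟨g, hg.mono le_rfl (by omega), rfl⟩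

theorem exists_linearTerms_le [IsArtinianRing k] [Module.Finite k A] :
    ∃ N, ∀ n, linearTerms k A N ≤ linearTerms k A n := by
  have : Module.Finite k (Module.End k A) :=
    (inferInstance : Module.Finite k (A →ₗ[k] A))
  have : IsArtinian k (Module.End k A) := inferInstance
  obtain ⟨N, hN⟩ := IsArtinian.monotone_stabilizes
    (⟨fun n => OrderDual.toDual (linearTerms k A n), fun _ _ h => linearTerms_antitone h⟩ :
      ℕ →o (Submodule k (Module.End k A))ᵒᵈ)
  refine ⟨N, fun n => ?_⟩
  rcases le_total N n with h | h
  · exact (congrArg OrderDual.ofDual (hN n h)).le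
  · exact linearTerms_antitone h

/-- The truncation of `g` in degree `j` extends to solutions of arbitrarily high order. -/
def IsExtendable (j : ℕ) (g : (Module.End k A)⟦X⟧) : Prop :=
  ∀ n, ∃ h, IsHSBelow 1 n h ∧ ∀ i ≤ j, coeff i h = coeff i g

theorem IsExtendable.exists_succ [IsArtinianRing k] [Module.Finite k A] {j : ℕ}
    {g : (Module.End k A)⟦X⟧} (hg : IsExtendable j g) :
    ∃ g', IsExtendable (j + 1) g' ∧ ∀ i ≤ j, coeff i g' = coeff i g := by
  obtain ⟨N, hN⟩ := exists_linearTerms_le (k := k) (A := A)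
  obtain ⟨g', hg', hg'g⟩ := hg ((j + 1) * N + 1)
  refine ⟨g', fun n => ?_, hg'g⟩
  obtain ⟨h, hh, hhg⟩ := hg (max n ((j + 1) * N + 1))
  have hhn := hh.mono le_rfl (le_max_left _ _)
  obtain ⟨v, hv, hhv⟩ := (hh.mono le_rfl (le_max_right _ _)).exists_inverse one_pos
  have hvh : v * h = 1 := by
    obtain ⟨w, -, hvw⟩ := hv.exists_inverse one_pos
    rwa [left_inv_eq_right_inv hhv hvw]
  have hvg := hv.mul hg'
  have low (i : ℕ) (h0 : 0 < i) (hi : i < j + 1) : coeff i (v * g') = 0 := by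
    have : coeff i (v * g') = coeff i (v * h) := by
      rw [coeff_mul, coeff_mul]
      refine Finset.sum_congr rfl fun p hp => ?_
      rw [HasAntidiagonal.mem_antidiagonal] at hp
      rw [hg'g p.2 (by omega), hhg p.2 (by omega)]
    rw [this, hvh, coeff_one, if_neg h0.ne']
  obtain ⟨b, hb, hb1⟩ := leadingCoeffsLift N (j + 1) (Nat.succ_pos j) (v * g')
    ⟨hvg.coeff_zero, low, hvg.defect_eq_zero⟩
  obtain ⟨w, hw, hw1⟩ := hN n ⟨b, hb, hb1⟩
  have hs := hw.substVar (Nat.succ_pos j) (f := C 1 * X ^ (j + 1)) (Dvd.intro_left _ rfl)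
  have hs1 := coeff_substVar_monomial 1 (Nat.succ_pos j) w 1
  rw [mul_one, one_pow, one_smul, hw1] at hs1
  refine ⟨h * substVar (C 1 * X ^ (j + 1)) w,
    hhn.mul (hs.mono (Nat.succ_pos j) (by nlinarith)), fun i hi => ?_⟩
  have e (a : ℕ) (ha : a ≤ j + 1) :
      coeff a (substVar (C 1 * X ^ (j + 1)) w) = coeff a (v * g') := by
    rcases Nat.eq_zero_or_pos a with rfl | h0
    · rw [hs.coeff_zero, hvg.coeff_zero]
    · rcases ha.eq_or_lt with rfl | ha
      · exact hs1
      · rw [hs.coeff_eq_zero a h0 ha, low a h0 ha]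
  have hg'' : g' = h * (v * g') := by rw [← mul_assoc, hhv, one_mul]
  rw [hg'', coeff_mul, coeff_mul]
  refine Finset.sum_congr rfl fun p hp => ?_
  rw [HasAntidiagonal.mem_antidiagonal] at hp
  rw [e p.2 (by omega), hg'']

theorem exists_of_forall_mem_linearTerms [IsArtinianRing k] [Module.Finite k A]
    {D : Module.End k A} (hD : ∀ n, D ∈ linearTerms k A n) :
    ∃ g : (Module.End k A)⟦X⟧, coeff 0 g = 1 ∧ coeff 1 g = D ∧ ∀ n, defect g n = 0 := by
  have start : IsExtendable 1 (PowerSeries.mk fun i => if i = 0 then 1 else D) := by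
    intro n
    obtain ⟨g, hg, hgD⟩ := hD n
    refine ⟨g, hg.mono le_rfl (Nat.le_succ n), fun i hi => ?_⟩
    interval_cases i
    · rw [hg.coeff_zero, coeff_mk, if_pos rfl]
    · rw [hgD, coeff_mk, if_neg one_ne_zero]
  choose next hnext hagree using
    fun (j : ℕ) (g : {g : (Module.End k A)⟦X⟧ // IsExtendable j g}) => g.2.exists_succ
  let F : (j : ℕ) → {g : (Module.End k A)⟦X⟧ // IsExtendable (j + 1) g} :=
    Nat.rec ⟨_, start⟩ fun j g => ⟨next (j + 1) g, hnext (j + 1) g⟩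
  have stable (j m i : ℕ) (hi : i ≤ j + 1) : coeff i (F (j + m)).1 = coeff i (F j).1 := by
    induction m with
    | zero => rfl
    | succ m ih => rw [← ih]; exact hagree (j + m + 1) (F (j + m)) i (by omega)
  have hcoeff (j i : ℕ) (hi : i ≤ j) :
      coeff i (PowerSeries.mk fun i => coeff i (F i).1) = coeff i (F j).1 := by
    obtain ⟨m, rfl⟩ := Nat.exists_eq_add_of_le hi
    rw [coeff_mk, stable i m i (Nat.le_succ i)]
  refine ⟨PowerSeries.mk fun i => coeff i (F i).1, ?_, ?_, fun n => ?_⟩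
  · rw [hcoeff 0 0 le_rfl]
    simp [F]
  · rw [hcoeff 1 1 le_rfl]
    exact (stable 0 1 1 le_rfl).trans (by simp [F])
  · obtain ⟨h, hh, hhF⟩ := (F n).2 (n + 1)
    rw [defect_congr (h := h) fun i hi => by rw [hcoeff n i hi, hhF i (by omega)]]
    exact hh.defect_eq_zero n (Nat.lt_succ_self n)

theorem isInfIntegrable_iff {m : ℕ} {D : A →ₗ[k] A} : IsInfIntegrable k A m D ↔
    ∃ g : (Module.End k A)⟦X⟧, (∀ n, IsHSBelow m n g) ∧ coeff m g = D := by
  constructor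
  · rintro ⟨α, h0, hlow, hm, hmul⟩
    refine ⟨PowerSeries.mk α, fun n => ⟨by rw [coeff_mk, h0]; rfl, fun i hi0 hi => ?_,
      fun i _ => ?_⟩, by rw [coeff_mk, hm]⟩
    · rw [coeff_mk, hlow i hi0 hi]
    · ext x y
      simp only [defect, coeff_mk]
      rw [hmul, Finset.Nat.sum_antidiagonal_eq_sum_range_succ fun a b => α a x * α b y, sub_self]
      rfl
  · rintro ⟨g, hg, hgD⟩
    refine ⟨fun n => coeff n g, (hg 0).coeff_zero, (hg 0).coeff_eq_zero, hgD, fun i x y => ?_⟩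
    have := congrFun (congrFun ((hg (i + 1)).defect_eq_zero i (Nat.lt_succ_self i)) x) y
    rw [defect, Finset.Nat.sum_antidiagonal_eq_sum_range_succ
      fun a b => coeff a g x * coeff b g y] at this
    exact sub_eq_zero.mp this

end HasseSchmidt

open HasseSchmidt PowerSeries in
/-- For an Artin algebra `A` over a commutative Artinian ring `k`, a derivation
is `[1,∞]`-integrable iff it is `[m,∞]`-integrable. -/
theorem statement7 (k : Type*) [CommRing k] [IsArtinianRing k]
    (A : Type*) [Ring A] [Algebra k A] [Module.Finite k A]
    (m : ℕ) (hm : 1 ≤ m)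
    (D : A →ₗ[k] A) (hD : IsDerivation k A D) :
    IsInfIntegrable k A 1 D ↔ IsInfIntegrable k A m D := by
  rw [isInfIntegrable_iff, isInfIntegrable_iff]
  constructor
  · rintro ⟨g, hg, rfl⟩
    refine ⟨substVar (C 1 * X ^ m) g, fun n => ?_, ?_⟩
    · exact ((hg n).substVar hm (Dvd.intro_left _ rfl)).mono le_rfl (Nat.le_mul_of_pos_left n hm)
    · have := coeff_substVar_monomial 1 hm g 1
      rwa [mul_one, one_pow, one_smul] at this
  · rintro ⟨g, hg, rfl⟩
    obtain ⟨h, h0, h1, hh⟩ := exists_of_forall_mem_linearTerms (k := k) (A := A)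
      (D := coeff m g) fun n => leadingCoeffsLift n m hm g (hg _)
    exact ⟨h, fun n => ⟨h0, fun _ _ _ => by omega, fun i _ => hh i⟩, h1⟩
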